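/- arXiv:2603.10219 — 3 statements merged into one kernel-verified Lean document; each statement's English description precedes it below -/
import Mathlib

section
/- Let k ≥ 1 be an integer, let n ≥ 3 be a real number, let δ ∈ (0,1), and set L = log(n/δ). Suppose θ ∈ ℝ^k satisfies ∑_{a=1}^k θ_a = 0, −L ≤ θ_a ≤ kL for every a ∈ {1,…,k}, and θ_1 ≥ θ_a − 1 for every a ∈ {1,…,k}. Then, with π = π(θ) the softmax vector, 1/π_1 ≤ 6 k L / (θ_1 + 1 + L). -/
/-- On `[-L, M]` the exponential lies below its chord. -/
theorem exp_mul_add_le_chord {x L M : ℝ} (hD : 0 < M + L) (hl : -L ≤ x) (hu : x ≤ M) :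
    Real.exp x * (M + L) ≤ (M - x) * Real.exp (-L) + (x + L) * Real.exp M := by
  have h := convexOn_exp.2 (Set.mem_univ (-L)) (Set.mem_univ M)
    (div_nonneg (sub_nonneg.2 hu) hD.le) (div_nonneg (by linarith : 0 ≤ x + L) hD.le)
    (by field_simp; ring)
  simp only [smul_eq_mul] at h
  have hx : (M - x) / (M + L) * -L + (x + L) / (M + L) * M = x := by
    field_simp
    ring
  rw [hx] at h
  calc Real.exp x * (M + L)
      ≤ ((M - x) / (M + L) * Real.exp (-L) + (x + L) / (M + L) * Real.exp M) * (M + L) :=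
        mul_le_mul_of_nonneg_right h hD.le
    _ = _ := by field_simp

/-- A zero-sum vector with entries in `[-L, M]` has exponential sum bounded by the chord at `0`. -/
theorem sum_exp_mul_add_le {ι : Type*} [Fintype ι] {θ : ι → ℝ} {L M : ℝ} (hD : 0 < M + L)
    (hsum : ∑ a, θ a = 0) (hl : ∀ a, -L ≤ θ a) (hu : ∀ a, θ a ≤ M) :
    (∑ a, Real.exp (θ a)) * (M + L) ≤
      Fintype.card ι * (M * Real.exp (-L) + L * Real.exp M) := by
  rw [Finset.sum_mul]
  refine (Finset.sum_le_sum fun a _ => exp_mul_add_le_chord hD (hl a) (hu a)).trans_eq ?_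
  simp only [Finset.sum_add_distrib, ← Finset.sum_mul, Finset.sum_sub_distrib, hsum,
    Finset.sum_const, Finset.card_univ, nsmul_eq_mul]
  ring


open Finset in
/-- Lemma 3 (lem:pi): if `∑ θ_a = 0`, `-L ≤ θ_a ≤ kL` for all `a`, and `θ_1 ≥ θ_a - 1`
for all `a`, where `L = log(n/δ)`, then the softmax probability of action 1 satisfies
`1/π_1 ≤ 6kL/(θ_1 + 1 + L)`. -/
theorem softmax_first_coord_bound (k : ℕ) (hk : 1 ≤ k) (n δ L : ℝ) (hn : 3 ≤ n)
    (hδ : δ ∈ Set.Ioo (0 : ℝ) 1) (hL : L = Real.log (n / δ)) (θ : Fin k → ℝ)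
    (hsum : ∑ a, θ a = 0)
    (hlb : ∀ a, -L ≤ θ a) (hub : ∀ a, θ a ≤ k * L)
    (hmax : ∀ a, θ ⟨0, by omega⟩ ≥ θ a - 1) :
    1 / (Real.exp (θ ⟨0, by omega⟩) / ∑ b, Real.exp (θ b)) ≤
      6 * k * L / (θ ⟨0, by omega⟩ + 1 + L) := by
  obtain ⟨hδ0, hδ1⟩ := hδ
  have hL1 : 1 ≤ L := by
    rw [hL, Real.le_log_iff_exp_le (by positivity), le_div_iff₀ hδ0]
    nlinarith [Real.exp_one_lt_d9, Real.exp_pos 1]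
  set t := θ ⟨0, by omega⟩
  have hu : ∀ a, θ a ≤ t + 1 := fun a => by linarith [hmax a]
  have hM : 0 ≤ t + 1 := by
    have h : ∑ a, θ a ≤ k * (t + 1) := by
      simpa [mul_add] using Finset.sum_le_sum fun a (_ : a ∈ univ) => hu a
    rw [hsum] at h
    exact nonneg_of_mul_nonneg_right h (by exact_mod_cast hk)
  have hD : 0 < t + 1 + L := by linarith
  have hS := sum_exp_mul_add_le hD hsum hlb hu
  rw [Fintype.card_fin] at hS
  rw [one_div_div, div_le_div_iff₀ (Real.exp_pos t) hD]
  have hexp : (t + 1) * Real.exp (-L) ≤ L * Real.exp (t + 1) := by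
    rw [mul_comm L]
    refine mul_le_mul ?_ ?_ (Real.exp_pos _).le (Real.exp_pos _).le
    · linarith [Real.add_one_le_exp (t + 1)]
    · linarith [Real.exp_le_one_iff.2 (by linarith : -L ≤ 0)]
  have he : Real.exp (t + 1) ≤ 3 * Real.exp t := by
    rw [Real.exp_add, mul_comm]
    exact mul_le_mul_of_nonneg_right (by linarith [Real.exp_one_lt_d9]) (Real.exp_pos t).le
  calc (∑ a, Real.exp (θ a)) * (t + 1 + L)
      ≤ k * ((t + 1) * Real.exp (-L) + L * Real.exp (t + 1)) := hS
    _ ≤ k * (L * (3 * Real.exp t) + L * (3 * Real.exp t)) := by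
        have := mul_le_mul_of_nonneg_left he (by linarith : 0 ≤ L)
        exact mul_le_mul_of_nonneg_left (add_le_add (hexp.trans this) this) k.cast_nonneg
    _ = 6 * k * L * Real.exp t := by ring
end

section
/- Let m > 0 and let a ≤ 0 ≤ b be real numbers with a < b. For every Lebesgue-measurable function f : [0,m] → ℝ with a ≤ f(x) ≤ b for almost every x and ∫₀^m f(x) dx = 0, one has ∫₀^m exp(f(x)) dx ≤ m · [ (b/(b−a))·exp(a) − (a/(b−a))·exp(b) ]. Moreover this bound is attained: the supremum of ∫₀^m exp(f(x)) dx over all such f equals m[(b/(b−a))e^a − (a/(b−a))e^b]. -/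
/-- A convex function on `[a, b]` lies below its chord. -/
theorem ConvexOn.le_chord {g : ℝ → ℝ} {a b x : ℝ} (hg : ConvexOn ℝ (Set.Icc a b) g)
    (hab : a < b) (hx : x ∈ Set.Icc a b) :
    g x ≤ (b / (b - a) * g a - a / (b - a) * g b) + (g b - g a) / (b - a) * x := by
  have hpos : 0 < b - a := sub_pos.2 hab
  have h := hg.2 (Set.left_mem_Icc.2 hab.le) (Set.right_mem_Icc.2 hab.le)
    (div_nonneg (sub_nonneg.2 hx.2) hpos.le) (div_nonneg (sub_nonneg.2 hx.1) hpos.le)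
    (by field_simp; ring)
  simp only [smul_eq_mul] at h
  have hcomb : (b - x) / (b - a) * a + (x - a) / (b - a) * b = x := by
    field_simp
    ring
  rw [hcomb] at h
  refine h.trans_eq ?_
  field_simp
  ring

open MeasureTheory in
/-- The integral of `exp ∘ f` for a mean-zero function `f` with values in `[a, b]` is at most
that of a mean-zero function taking only the values `a` and `b`. -/
theorem integral_exp_le_of_mem_Icc_of_integral_eq_zero {α : Type*} [MeasurableSpace α]
    {μ : Measure α} [IsFiniteMeasure μ] {f : α → ℝ} {a b : ℝ} (hab : a < b)
    (hf : AEMeasurable f μ) (hmem : ∀ᵐ x ∂μ, f x ∈ Set.Icc a b) (hzero : ∫ x, f x ∂μ = 0) :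
    ∫ x, Real.exp (f x) ∂μ ≤
      μ.real Set.univ * (b / (b - a) * Real.exp a - a / (b - a) * Real.exp b) := by
  have hint : Integrable f μ := .of_mem_Icc a b hf hmem
  have hexp : Integrable (fun x => Real.exp (f x)) μ :=
    .of_mem_Icc (Real.exp a) (Real.exp b) (Real.measurable_exp.comp_aemeasurable hf)
      (hmem.mono fun x hx => ⟨Real.exp_le_exp.2 hx.1, Real.exp_le_exp.2 hx.2⟩)
  have hconv : ConvexOn ℝ (Set.Icc a b) Real.exp :=
    convexOn_exp.subset (Set.subset_univ _) (convex_Icc a b)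
  refine (integral_mono_ae hexp ((integrable_const _).add (hint.const_mul _))
    (hmem.mono fun x hx => hconv.le_chord hab hx)).trans_eq ?_
  simp only [Pi.add_apply]
  rw [integral_add (integrable_const _) (hint.const_mul _), integral_const_mul, hzero,
    integral_const, smul_eq_mul, mul_zero, add_zero]

open MeasureTheory in
/-- The integral over `[0, m]` of a function of a two-valued step function. -/
theorem setIntegral_Icc_comp_step (g : ℝ → ℝ) (a b : ℝ) {c m : ℝ} (hc : 0 ≤ c) (hcm : c ≤ m) :
    ∫ x in Set.Icc 0 m, g (if x ≤ c then a else b) = c * g a + (m - c) * g b := by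
  have hleft : Set.EqOn (fun x => g (if x ≤ c then a else b)) (fun _ => g a) (Set.Icc 0 c) :=
    fun x hx => by simp [hx.2]
  have hright : Set.EqOn (fun x => g (if x ≤ c then a else b)) (fun _ => g b) (Set.Ioc c m) :=
    fun x hx => by simp [hx.1.not_ge]
  have hdisj : Disjoint (Set.Icc 0 c) (Set.Ioc c m) :=
    Set.disjoint_left.2 fun x hx hx' => hx'.1.not_ge hx.2
  rw [← Set.Icc_union_Ioc_eq_Icc hc hcm, setIntegral_union hdisj measurableSet_Ioc
    ((integrableOn_congr_fun hleft measurableSet_Icc).2 (integrableOn_const (by simp)))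
    ((integrableOn_congr_fun hright measurableSet_Ioc).2 (integrableOn_const (by simp))),
    setIntegral_congr_fun measurableSet_Icc hleft, setIntegral_congr_fun measurableSet_Ioc hright]
  simp [hc, hcm]

open MeasureTheory in
/-- Continuous extremal problem: over measurable `f : [0,m] → [a,b]` with `∫₀^m f = 0`,
every such `f` satisfies `∫₀^m exp(f) ≤ m[(b/(b-a))e^a - (a/(b-a))e^b]`, and this bound
is the supremum of the integrals. -/
theorem integral_exp_extremal (m a b : ℝ) (hm : 0 < m) (ha : a ≤ 0) (hb : 0 ≤ b)
    (hab : a < b) :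
    (∀ f : ℝ → ℝ, Measurable f →
      (∀ᵐ x ∂(volume.restrict (Set.Icc 0 m)), f x ∈ Set.Icc a b) →
      (∫ x in Set.Icc 0 m, f x) = 0 →
      (∫ x in Set.Icc 0 m, Real.exp (f x)) ≤
        m * (b / (b - a) * Real.exp a - a / (b - a) * Real.exp b)) ∧
    sSup {y : ℝ | ∃ f : ℝ → ℝ, Measurable f ∧
        (∀ᵐ x ∂(volume.restrict (Set.Icc 0 m)), f x ∈ Set.Icc a b) ∧
        (∫ x in Set.Icc 0 m, f x) = 0 ∧
        y = ∫ x in Set.Icc 0 m, Real.exp (f x)} =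
      m * (b / (b - a) * Real.exp a - a / (b - a) * Real.exp b) := by
  have hpos : 0 < b - a := sub_pos.2 hab
  have hle : ∀ f : ℝ → ℝ, Measurable f →
      (∀ᵐ x ∂(volume.restrict (Set.Icc 0 m)), f x ∈ Set.Icc a b) →
      (∫ x in Set.Icc 0 m, f x) = 0 →
      (∫ x in Set.Icc 0 m, Real.exp (f x)) ≤
        m * (b / (b - a) * Real.exp a - a / (b - a) * Real.exp b) := by
    intro f hf hmem hzero
    simpa [hm.le] using
      integral_exp_le_of_mem_Icc_of_integral_eq_zero hab hf.aemeasurable hmem hzero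
  refine ⟨hle, IsGreatest.csSup_eq ⟨?_, ?_⟩⟩
  · have hc : 0 ≤ m * b / (b - a) := by positivity
    have hcm : m * b / (b - a) ≤ m := by
      rw [div_le_iff₀ hpos]
      nlinarith
    refine ⟨fun x => if x ≤ m * b / (b - a) then a else b,
      Measurable.ite measurableSet_Iic measurable_const measurable_const,
      .of_forall fun x => ?_, ?_, ?_⟩
    · dsimp only
      split_ifs
      exacts [Set.left_mem_Icc.2 hab.le, Set.right_mem_Icc.2 hab.le]
    · refine (setIntegral_Icc_comp_step id a b hc hcm).trans ?_
      simp only [id]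
      field_simp
      ring
    · rw [setIntegral_Icc_comp_step Real.exp a b hc hcm]
      field_simp
      ring
  · rintro y ⟨f, hf, hmem, hzero, rfl⟩
    exact hle f hf hmem hzero
end

section
/- Let k ≥ 1 be an integer, let n ≥ 3 be a real number, let δ ∈ (0,1), and set L = log(n/δ). Suppose θ ∈ ℝ^k satisfies ∑_{a=1}^k θ_a = 0, −L ≤ θ_a ≤ kL for every a, and θ_1 ≥ θ_a − 1 for every a. Then ∑_{a=1}^k exp(θ_a) ≤ kδ/n + (k L / (θ_1 + 1 + L)) · exp(θ_1 + 1). -/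
/-- On `[a, b]` the exponential lies below its chord. -/
theorem Real.exp_le_chord {a b x : ℝ} (hab : a < b) (hax : a ≤ x) (hxb : x ≤ b) :
    Real.exp x ≤ ((b - x) * Real.exp a + (x - a) * Real.exp b) / (b - a) := by
  have hd : 0 < b - a := sub_pos.2 hab
  have h := convexOn_exp.2 (Set.mem_univ a) (Set.mem_univ b)
    (div_nonneg (sub_nonneg.2 hxb) hd.le) (div_nonneg (sub_nonneg.2 hax) hd.le)
    (by field_simp; ring)
  have hx : (b - x) / (b - a) * a + (x - a) / (b - a) * b = x := by field_simp; ring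
  simp only [smul_eq_mul, hx] at h
  exact h.trans_eq (by ring)

/-- The sum of exponentials of numbers in `[a, b]` with zero sum is bounded by the value of the
chord of `exp` at `0`. -/
theorem Finset.sum_exp_le_of_sum_eq_zero {ι : Type*} [Fintype ι] {a b : ℝ} (hab : a < b)
    (x : ι → ℝ) (hsum : ∑ i, x i = 0) (hax : ∀ i, a ≤ x i) (hxb : ∀ i, x i ≤ b) :
    ∑ i, Real.exp (x i) ≤
      Fintype.card ι * (b * Real.exp a - a * Real.exp b) / (b - a) := by
  refine (Finset.sum_le_sum fun i _ => Real.exp_le_chord hab (hax i) (hxb i)).trans_eq ?_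
  rw [← Finset.sum_div, Finset.sum_add_distrib, ← Finset.sum_mul, ← Finset.sum_mul,
    Finset.sum_sub_distrib, Finset.sum_sub_distrib, hsum]
  simp only [Finset.sum_const, Finset.card_univ, nsmul_eq_mul]
  ring


open Finset in
/-- Intermediate bound in Lemma 3 (lem:pi): under the conservation and boundedness
hypotheses, `∑ exp(θ_a) ≤ kδ/n + (kL/(θ_1 + 1 + L))·exp(θ_1 + 1)` where `L = log(n/δ)`. -/
theorem sum_exp_theta_bound (k : ℕ) (hk : 1 ≤ k) (n δ L : ℝ) (hn : 3 ≤ n)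
    (hδ : δ ∈ Set.Ioo (0 : ℝ) 1) (hL : L = Real.log (n / δ)) (θ : Fin k → ℝ)
    (hsum : ∑ a, θ a = 0)
    (hlb : ∀ a, -L ≤ θ a) (hub : ∀ a, θ a ≤ k * L)
    (hmax : ∀ a, θ ⟨0, by omega⟩ ≥ θ a - 1) :
    ∑ a, Real.exp (θ a) ≤
      k * δ / n + (k * L / (θ ⟨0, by omega⟩ + 1 + L)) * Real.exp (θ ⟨0, by omega⟩ + 1) := by
  have hn0 : 0 < n := by linarith
  have hδ0 : 0 < δ := hδ.1
  have hL0 : 0 < L := by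
    rw [hL]
    exact Real.log_pos ((one_lt_div hδ0).2 (by linarith [hδ.2]))
  have hexp : Real.exp (-L) = δ / n := by
    rw [hL, Real.exp_neg, Real.exp_log (by positivity), inv_div]
  have hk0 : (0 : ℝ) < k := by exact_mod_cast hk
  set b := θ ⟨0, by omega⟩ + 1 with hb
  have hθb : ∀ a, θ a ≤ b := fun a => by linarith [hmax a]
  have hb0 : 0 ≤ b := by
    have h : ∑ a, θ a ≤ ∑ _a : Fin k, b := Finset.sum_le_sum fun a _ => hθb a
    rw [hsum, Finset.sum_const, Finset.card_univ, Fintype.card_fin, nsmul_eq_mul] at h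
    exact nonneg_of_mul_nonneg_right h hk0
  have hbL : 0 < b + L := by linarith
  have h := Finset.sum_exp_le_of_sum_eq_zero (by linarith : -L < b) θ hsum hlb hθb
  rw [Fintype.card_fin, hexp, sub_neg_eq_add] at h
  have hfrac : b / (b + L) ≤ 1 := (div_le_one hbL).2 (by linarith)
  calc ∑ a, Real.exp (θ a)
      ≤ k * (b * (δ / n) - -L * Real.exp b) / (b + L) := h
    _ = k * δ / n * (b / (b + L)) + k * L / (b + L) * Real.exp b := by ring
    _ ≤ k * δ / n + k * L / (b + L) * Real.exp b := by
      gcongr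
      exact mul_le_of_le_one_right (by positivity) hfrac
end
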